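/- Under the variable metric forward–backward setup, if in addition liminf_{n→∞} infDist(x_n, Z) = 0 (where infDist denotes the infimum of distances to the set Z), then the sequence (x_n) converges strongly to some point x̄ ∈ Z. -/

import Mathlib

open RealInnerProductSpace Filter Topology

section PositiveOperator

variable {H : Type*} [NormedAddCommGroup H] [InnerProductSpace ℝ H]

/-- A coercive bounded operator on a real Hilbert space has a bounded right inverse. -/
lemma exists_right_inverse_of_coercive [CompleteSpace H] (U : H →L[ℝ] H) {α : ℝ} (hα : 0 < α)
    (h : ∀ x : H, α * ‖x‖ ^ 2 ≤ ⟪U x, x⟫) : ∃ W : H →L[ℝ] H, ∀ x, U (W x) = x := by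
  have hc : IsCoercive ((innerSL ℝ).comp U) :=
    ⟨α, hα, fun u => by simpa [pow_two, mul_assoc] using h u⟩
  refine ⟨(hc.continuousLinearEquivOfBilin.symm : H →L[ℝ] H), fun x => ?_⟩
  refine ext_inner_right ℝ fun w => ?_
  have := hc.continuousLinearEquivOfBilin_apply (hc.continuousLinearEquivOfBilin.symm x) w
  simpa using this.symm

variable {U U' W W' : H →L[ℝ] H}

lemma inner_right_inverse_comm (hU : ∀ x y : H, ⟪U x, y⟫ = ⟪x, U y⟫)
    (hW : ∀ x, U (W x) = x) (x y : H) : ⟪W x, y⟫ = ⟪x, W y⟫ := by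
  rw [← hW y, ← hU, hW x, hW y]

lemma inner_right_inverse_nonneg (hpos : ∀ x : H, 0 ≤ ⟪U x, x⟫)
    (hW : ∀ x, U (W x) = x) (x : H) : 0 ≤ ⟪W x, x⟫ := by
  have := hpos (W x)
  rwa [hW, real_inner_comm] at this

lemma inner_sub_smul_self (hU : ∀ x y : H, ⟪U x, y⟫ = ⟪x, U y⟫) (p q : H) (t : ℝ) :
    ⟪U (p - t • q), p - t • q⟫ = ⟪U p, p⟫ - 2 * t * ⟪p, U q⟫ + t ^ 2 * ⟪U q, q⟫ := by
  simp only [map_sub, map_smul, inner_sub_left, inner_sub_right, real_inner_smul_left,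
    real_inner_smul_right, hU p q, real_inner_comm p (U q)]
  ring

/-- Inversion reverses the order of positive operators. -/
lemma inner_right_inverse_le_mul (hU : ∀ x y : H, ⟪U x, y⟫ = ⟪x, U y⟫)
    (hpos : ∀ x : H, 0 ≤ ⟪U x, x⟫) (hW : ∀ x, U (W x) = x) (hW' : ∀ x, U' (W' x) = x)
    {c : ℝ} (hc : 0 < c) (hle : ∀ x : H, ⟪U x, x⟫ ≤ c * ⟪U' x, x⟫) (v : H) :
    ⟪W' v, v⟫ ≤ c * ⟪W v, v⟫ := by
  have h1 := hpos (W' v - c • W v)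
  rw [inner_sub_smul_self hU, hW, real_inner_comm (W v) v] at h1
  have h2 := hle (W' v)
  rw [hW', real_inner_comm (W' v) v] at h2
  refine le_of_mul_le_mul_left ?_ hc
  nlinarith

lemma norm_sq_le_mul_inner_right_inverse (hU : ∀ x y : H, ⟪U x, y⟫ = ⟪x, U y⟫)
    (hpos : ∀ x : H, 0 ≤ ⟪U x, x⟫) (hW : ∀ x, U (W x) = x)
    {c : ℝ} (hc : 0 < c) (hle : ‖U‖ ≤ c) (v : H) : ‖v‖ ^ 2 ≤ c * ⟪W v, v⟫ := by
  have h1 := hpos (W v - c⁻¹ • v)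
  rw [inner_sub_smul_self hU, hW, ← hU, hW, real_inner_self_eq_norm_sq,
    real_inner_comm (W v) v] at h1
  have h2 : ⟪U v, v⟫ ≤ c * ‖v‖ ^ 2 := by
    calc ⟪U v, v⟫ ≤ ‖U v‖ * ‖v‖ := real_inner_le_norm _ _
      _ ≤ (c * ‖v‖) * ‖v‖ := by gcongr; exact U.le_of_opNorm_le hle v
      _ = _ := by ring
  have h3 := mul_le_mul_of_nonneg_left h2 (sq_nonneg c⁻¹)
  have h4 : c⁻¹ ^ 2 * (c * ‖v‖ ^ 2) = c⁻¹ * ‖v‖ ^ 2 := by field_simp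
  have h5 : c⁻¹ * ‖v‖ ^ 2 ≤ ⟪W v, v⟫ := by linarith
  rwa [inv_mul_le_iff₀ hc] at h5

lemma inner_right_inverse_le {α : ℝ} (hα : 0 < α)
    (h : ∀ x : H, α * ‖x‖ ^ 2 ≤ ⟪U x, x⟫) (hW : ∀ x, U (W x) = x) (v : H) :
    ⟪W v, v⟫ ≤ α⁻¹ * ‖v‖ ^ 2 := by
  have h1 := h (W v)
  rw [hW, real_inner_comm] at h1
  have h2 := real_inner_le_norm (W v) v
  rw [← div_eq_inv_mul, le_div_iff₀ hα]
  nlinarith [sq_nonneg (α * ‖W v‖ - ‖v‖)]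

/-- The seminorm attached to a positive self-adjoint operator. -/
noncomputable def operatorNorm (W : H →L[ℝ] H) (v : H) : ℝ := √⟪W v, v⟫

lemma operatorNorm_nonneg (v : H) : 0 ≤ operatorNorm W v := Real.sqrt_nonneg _

lemma operatorNorm_sq (hpos : ∀ x : H, 0 ≤ ⟪W x, x⟫) (v : H) :
    operatorNorm W v ^ 2 = ⟪W v, v⟫ := Real.sq_sqrt (hpos v)

lemma inner_sq_le_of_symm_of_nonneg (hsym : ∀ x y : H, ⟪W x, y⟫ = ⟪x, W y⟫)
    (hpos : ∀ x : H, 0 ≤ ⟪W x, x⟫) (v w : H) : ⟪v, W w⟫ ^ 2 ≤ ⟪W v, v⟫ * ⟪W w, w⟫ := by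
  have h : ∀ t : ℝ, 0 ≤ ⟪W w, w⟫ * (t * t) + (-2 * ⟪v, W w⟫) * t + ⟪W v, v⟫ := fun t => by
    have := hpos (v - t • w)
    rw [inner_sub_smul_self hsym] at this
    linarith
  have := discrim_le_zero h
  rw [discrim] at this
  linarith

lemma operatorNorm_add_le (hsym : ∀ x y : H, ⟪W x, y⟫ = ⟪x, W y⟫)
    (hpos : ∀ x : H, 0 ≤ ⟪W x, x⟫) (v w : H) :
    operatorNorm W (v + w) ≤ operatorNorm W v + operatorNorm W w := by
  have hv := operatorNorm_nonneg (W := W) v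
  have hw := operatorNorm_nonneg (W := W) w
  refine abs_le_of_sq_le_sq' ?_ (by positivity) |>.2
  have hcs : ⟪v, W w⟫ ≤ operatorNorm W v * operatorNorm W w := by
    refine abs_le_of_sq_le_sq' ?_ (by positivity) |>.2
    rw [mul_pow, operatorNorm_sq hpos, operatorNorm_sq hpos]
    exact inner_sq_le_of_symm_of_nonneg hsym hpos v w
  have hexp : ⟪W (v + w), v + w⟫ = ⟪W v, v⟫ + 2 * ⟪v, W w⟫ + ⟪W w, w⟫ := by
    have := inner_sub_smul_self hsym v w (-1)
    simp only [neg_smul, one_smul, sub_neg_eq_add] at this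
    rw [this]; ring
  rw [operatorNorm_sq hpos, hexp, ← operatorNorm_sq hpos v, ← operatorNorm_sq hpos w]
  nlinarith

lemma operatorNorm_smul {t : ℝ} (ht : 0 ≤ t) (v : H) :
    operatorNorm W (t • v) = t * operatorNorm W v := by
  rw [operatorNorm, map_smul, real_inner_smul_left, real_inner_smul_right, ← mul_assoc,
    Real.sqrt_mul (mul_nonneg ht ht), Real.sqrt_mul_self ht, operatorNorm]

lemma operatorNorm_le_mul {c : ℝ} {w : H} (hc : 0 ≤ c)
    (h : ∀ v : H, ⟪W' v, v⟫ ≤ c * ⟪W v, v⟫) :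
    operatorNorm W' w ≤ √c * operatorNorm W w := by
  rw [operatorNorm, operatorNorm, ← Real.sqrt_mul hc]
  exact Real.sqrt_le_sqrt (h w)

/-- Forward–backward step: the distance to a zero, measured in the inverse metric, grows at
most by a multiple of the evaluation error. -/
lemma operatorNorm_forward_backward_le
    (hWsym : ∀ x y : H, ⟪W x, y⟫ = ⟪x, W y⟫) (hWpos : ∀ x : H, 0 ≤ ⟪W x, x⟫)
    {β μ γ : ℝ} (hβ : 0 < β) (hμ : 0 ≤ μ) (hγ : 0 ≤ γ) (hγμ : γ * μ ≤ 2 * β)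
    (hWμ : ∀ v : H, ‖v‖ ^ 2 ≤ μ * ⟪W v, v⟫)
    {x p z u Bx Bz b : H} (hB : β * ‖Bx - Bz‖ ^ 2 ≤ ⟪x - z, Bx - Bz⟫)
    (hu : γ • u = W (x - p) - γ • (Bx + b)) (hmono : 0 ≤ ⟪p - z, u + Bz⟫) :
    operatorNorm W (p - z) ≤ operatorNorm W (x - z) + 2 * (γ * √μ) * ‖b‖ := by
  have hP0 := operatorNorm_nonneg (W := W) (p - z)
  have hX0 := operatorNorm_nonneg (W := W) (x - z)
  have h1 : 0 ≤ ⟪p - z, W (x - p)⟫ - γ * ⟪p - z, Bx - Bz⟫ - γ * ⟪p - z, b⟫ := by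
    have h := mul_nonneg hγ hmono
    rw [← real_inner_smul_right, smul_add, hu] at h
    simp only [inner_add_right, inner_sub_right, real_inner_smul_right] at h ⊢
    linarith
  have h2 : 2 * ⟪p - z, W (x - p)⟫
      = ⟪W (x - z), x - z⟫ - ⟪W (p - z), p - z⟫ - ⟪W (x - p), x - p⟫ := by
    have := inner_sub_smul_self hWsym (p - z) (x - p) (-1)
    rw [neg_smul, one_smul, sub_neg_eq_add, show p - z + (x - p) = x - z by abel] at this
    linarith
  have h3 : -‖x - p‖ ^ 2 ≤ 4 * β * ⟪p - z, Bx - Bz⟫ := by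
    have e : ⟪p - z, Bx - Bz⟫ = ⟪x - z, Bx - Bz⟫ - ⟪x - p, Bx - Bz⟫ := by
      rw [← inner_sub_left]; congr 1; abel
    have := real_inner_le_norm (x - p) (Bx - Bz)
    rw [e]
    nlinarith [sq_nonneg (‖x - p‖ - 2 * β * ‖Bx - Bz‖)]
  have h4 : -⟪W (x - p), x - p⟫ ≤ 2 * (γ * ⟪p - z, Bx - Bz⟫) := by
    have h5 := mul_le_mul_of_nonneg_left (hWμ (x - p)) hγ
    have h6 := mul_le_mul_of_nonneg_right hγμ (hWpos (x - p))
    have h7 := mul_le_mul_of_nonneg_left h3 hγ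
    refine le_of_mul_le_mul_left ?_ (show 0 < 2 * β by positivity)
    linarith
  have h8 : ‖p - z‖ ≤ √μ * operatorNorm W (p - z) := by
    rw [operatorNorm, ← Real.sqrt_mul hμ]
    exact Real.le_sqrt_of_sq_le (hWμ _)
  have h9 : -⟪p - z, b⟫ ≤ √μ * operatorNorm W (p - z) * ‖b‖ := by
    calc -⟪p - z, b⟫ ≤ ‖p - z‖ * ‖b‖ := (neg_le_abs _).trans (abs_real_inner_le_norm _ _)
      _ ≤ _ := by gcongr
  have h10 := mul_le_mul_of_nonneg_left h9 hγ
  have h11 : operatorNorm W (p - z) ^ 2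
      ≤ operatorNorm W (x - z) ^ 2 + 2 * (γ * √μ * ‖b‖) * operatorNorm W (p - z) := by
    rw [operatorNorm_sq hWpos, operatorNorm_sq hWpos]
    linarith
  have hc : 0 ≤ γ * √μ * ‖b‖ := by positivity
  by_contra! hlt
  nlinarith

end PositiveOperator

/-- Discrete Gronwall inequality with summable coefficients. -/
lemma le_exp_tsum_mul_of_succ_le {d η e : ℕ → ℝ} (hη : ∀ n, 0 ≤ η n) (hηs : Summable η)
    (he : ∀ n, 0 ≤ e n) (hes : Summable e) (hd : ∀ n, 0 ≤ d n)
    (h : ∀ n, d (n + 1) ≤ (1 + η n) * (d n + e n)) (n m : ℕ) :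
    d (m + n) ≤ Real.exp (∑' k, η k) * (d n + ∑' k, e (k + n)) := by
  have key : ∀ m, d (m + n) ≤ Real.exp (∑ k ∈ Finset.range m, η (k + n))
      * (d n + ∑ k ∈ Finset.range m, e (k + n)) := by
    intro m
    induction m with
    | zero => simp
    | succ m ih =>
      have hE : 1 ≤ Real.exp (∑ k ∈ Finset.range m, η (k + n)) :=
        Real.one_le_exp (Finset.sum_nonneg fun k _ => hη _)
      have h1 : 1 + η (m + n) ≤ Real.exp (η (m + n)) := by
        linarith [Real.add_one_le_exp (η (m + n))]
      have h2 : d (m + n) + e (m + n) ≤ Real.exp (∑ k ∈ Finset.range m, η (k + n))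
          * (d n + ∑ k ∈ Finset.range m, e (k + n) + e (m + n)) := by
        nlinarith [he (m + n)]
      rw [Finset.sum_range_succ, Finset.sum_range_succ, Real.exp_add, add_right_comm m 1 n]
      calc d (m + n + 1) ≤ (1 + η (m + n)) * (d (m + n) + e (m + n)) := h _
        _ ≤ Real.exp (η (m + n)) * (d (m + n) + e (m + n)) :=
          mul_le_mul_of_nonneg_right h1 (add_nonneg (hd _) (he _))
        _ ≤ Real.exp (η (m + n)) * _ := mul_le_mul_of_nonneg_left h2 (Real.exp_nonneg _)
        _ = _ := by ring
  have hη1 : ∑ k ∈ Finset.range m, η (k + n) ≤ ∑' k, η k := by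
    refine (((summable_nat_add_iff n).2 hηs).sum_le_tsum _ fun k _ => hη _).trans ?_
    rw [← hηs.sum_add_tsum_nat_add n]
    exact le_add_of_nonneg_left (Finset.sum_nonneg fun k _ => hη _)
  have he1 : ∑ k ∈ Finset.range m, e (k + n) ≤ ∑' k, e (k + n) :=
    ((summable_nat_add_iff n).2 hes).sum_le_tsum _ fun k _ => he _
  refine (key m).trans ?_
  have h0 : 0 ≤ d n + ∑ k ∈ Finset.range m, e (k + n) :=
    add_nonneg (hd n) (Finset.sum_nonneg fun k _ => he _)
  gcongr

/-- A sequence whose later distances to every point of a closed set are controlled by its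
current distance up to a vanishing error, and which comes arbitrarily close to that set,
converges to a point of the set. -/
lemma exists_tendsto_of_dist_le_of_liminf_infDist {X : Type*} [MetricSpace X] [CompleteSpace X]
    {Z : Set X} (hZ : Z.Nonempty) (hZc : IsClosed Z) {x : ℕ → X} {C : ℝ} {r : ℕ → ℝ}
    (hC : 0 ≤ C) (hr : Tendsto r atTop (𝓝 0))
    (h : ∀ z ∈ Z, ∀ n m, n ≤ m → dist (x m) z ≤ C * (dist (x n) z + r n))
    (hlim : liminf (fun n => Metric.infDist (x n) Z) atTop = 0) :
    ∃ z ∈ Z, Tendsto x atTop (𝓝 z) := by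
  obtain ⟨z₀, hz₀⟩ := hZ
  have hcob : IsCoboundedUnder (· ≥ ·) atTop fun n => Metric.infDist (x n) Z :=
    (isBoundedUnder_of ⟨_, fun n => (Metric.infDist_le_dist_of_mem hz₀).trans
      (h z₀ hz₀ 0 n n.zero_le)⟩ : IsBoundedUnder (· ≤ ·) atTop _).isCoboundedUnder_ge
  have hclose : ∀ δ > 0, ∃ z ∈ Z, ∃ n, ∀ m ≥ n, dist (x m) z < δ := by
    intro δ hδ
    set t := δ / (2 * (C + 1)) with ht
    have ht0 : 0 < t := by positivity
    have hfreq : ∃ᶠ n in atTop, Metric.infDist (x n) Z < t :=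
      frequently_lt_of_liminf_lt hcob (by rw [hlim]; exact ht0)
    obtain ⟨n, hn, hrn⟩ := (hfreq.and_eventually (hr.eventually_lt_const ht0)).exists
    obtain ⟨z, hz, hxz⟩ := (Metric.infDist_lt_iff ⟨z₀, hz₀⟩).1 hn
    refine ⟨z, hz, n, fun m hm => (h z hz n m hm).trans_lt ?_⟩
    calc C * (dist (x n) z + r n) ≤ C * (t + t) := by gcongr
      _ < (C + 1) * (t + t) := by gcongr; linarith
      _ = δ := by rw [ht]; field_simp; ring
  have hcauchy : CauchySeq x := by
    refine Metric.cauchySeq_iff.2 fun δ hδ => ?_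
    obtain ⟨z, -, n, hn⟩ := hclose (δ / 2) (half_pos hδ)
    refine ⟨n, fun m hm k hk => ?_⟩
    have := dist_triangle_right (x m) (x k) z
    linarith [hn m hm, hn k hk]
  obtain ⟨xb, hxb⟩ := cauchySeq_tendsto_of_complete hcauchy
  refine ⟨xb, ?_, hxb⟩
  rw [← hZc.closure_eq, Metric.mem_closure_iff]
  intro δ hδ
  obtain ⟨z, hz, n, hn⟩ := hclose (δ / 2) (half_pos hδ)
  refine ⟨z, hz, (le_of_tendsto (hxb.dist tendsto_const_nhds)
    (eventually_atTop.2 ⟨n, fun m hm => (hn m hm).le⟩)).trans_lt (half_lt_self hδ)⟩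

section Zeros

variable {H : Type*} [NormedAddCommGroup H] [InnerProductSpace ℝ H]

lemma continuous_of_cocoercive {β : ℝ} (hβ : 0 < β) {B : H → H}
    (hB : ∀ x y : H, ⟪x - y, B x - B y⟫ ≥ β * ‖B x - B y‖ ^ 2) : Continuous B := by
  refine (LipschitzWith.of_dist_le_mul (K := ⟨β⁻¹, by positivity⟩) fun x y => ?_).continuous
  change dist (B x) (B y) ≤ β⁻¹ * dist x y
  rw [dist_eq_norm, dist_eq_norm, ← div_eq_inv_mul, le_div_iff₀ hβ]
  by_contra! hlt
  have h1 := (hB x y).trans (real_inner_le_norm _ _)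
  have h2 : 0 < ‖B x - B y‖ := by
    have := norm_nonneg (x - y)
    by_contra! h0
    nlinarith
  nlinarith

/-- The zeros of the sum of a maximally monotone and a continuous operator form a closed set. -/
lemma isClosed_setOf_neg_mem {A : H → Set H}
    (hAmono : ∀ x y u v : H, u ∈ A x → v ∈ A y → ⟪x - y, u - v⟫ ≥ 0)
    (hAmax : ∀ y v : H, (∀ x u : H, u ∈ A x → ⟪x - y, u - v⟫ ≥ 0) → v ∈ A y)
    {B : H → H} (hB : Continuous B) : IsClosed {x : H | -B x ∈ A x} := by
  have : {z : H | -B z ∈ A z}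
      = ⋂ (x : H) (u : H) (_ : u ∈ A x), {z : H | 0 ≤ ⟪x - z, u - -B z⟫} := by
    ext z
    simp only [Set.mem_iInter, Set.mem_ofPred_eq]
    exact ⟨fun hz x u hu => hAmono x z u _ hu hz, fun hz => hAmax z _ hz⟩
  rw [this]
  refine isClosed_iInter fun x => isClosed_iInter fun u => isClosed_iInter fun _ => ?_
  exact isClosed_le continuous_const (by fun_prop)

end Zeros

/-- **Variable metric forward–backward splitting: strong convergence under vanishing
distance.** Under the variable metric forward–backward setup, if
`liminf infDist (x n) Z = 0` then `x n` converges strongly to some point of `Z`. -/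
theorem variable_metric_forward_backward_strong_dist
    {H : Type*} [NormedAddCommGroup H] [InnerProductSpace ℝ H] [CompleteSpace H]
    (A : H → Set H)
    (hAmono : ∀ x y u v : H, u ∈ A x → v ∈ A y → ⟪x - y, u - v⟫ ≥ 0)
    (hAmax : ∀ y v : H, (∀ x u : H, u ∈ A x → ⟪x - y, u - v⟫ ≥ 0) → v ∈ A y)
    (β : ℝ) (hβ : 0 < β) (B : H → H)
    (hB : ∀ x y : H, ⟪x - y, B x - B y⟫ ≥ β * ‖B x - B y‖ ^ 2)
    (η : ℕ → ℝ) (hη0 : ∀ n, 0 ≤ η n) (hηsum : Summable η)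
    (α : ℝ) (hα : 0 < α)
    (U : ℕ → H →L[ℝ] H) (hUsa : ∀ n, IsSelfAdjoint (U n))
    (hUα : ∀ n (x : H), ⟪U n x, x⟫ ≥ α * ‖x‖ ^ 2)
    (μ : ℝ) (hμ : IsLUB (Set.range fun n => ‖U n‖) μ)
    (hUmono : ∀ n (x : H), (1 + η n) * ⟪U (n + 1) x, x⟫ ≥ ⟪U n x, x⟫)
    (ε : ℝ) (hε : ε ∈ Set.Ioc 0 (min 1 (2 * β / (μ + 1))))
    (lam : ℕ → ℝ) (hlam : ∀ n, lam n ∈ Set.Icc ε 1)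
    (gam : ℕ → ℝ) (hgam : ∀ n, gam n ∈ Set.Icc ε ((2 * β - ε) / μ))
    (a b : ℕ → H) (ha : Summable fun n => ‖a n‖) (hb : Summable fun n => ‖b n‖)
    (Z : Set H) (hZdef : Z = {x : H | -B x ∈ A x}) (hZ : Z.Nonempty)
    (x y p : ℕ → H)
    (hy : ∀ n, y n = x n - gam n • U n (B (x n) + b n))
    (hp : ∀ n, y n - p n ∈ (fun u => gam n • U n u) '' A (p n))
    (hx : ∀ n, x (n + 1) = x n + lam n • (p n + a n - x n))
    (hliminf : Filter.liminf (fun n => Metric.infDist (x n) Z) atTop = 0) :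
    ∃ xb ∈ Z, Tendsto x atTop (𝓝 xb) := by
  obtain ⟨hε0, -⟩ := hε
  have hUμ : ∀ n, ‖U n‖ ≤ μ := fun n => hμ.1 ⟨n, rfl⟩
  have hμ0 : 0 < μ := by
    refine lt_of_le_of_ne ((norm_nonneg _).trans (hUμ 0)) fun h => ?_
    have := (hgam 0).1.trans (hgam 0).2
    rw [← h, div_zero] at this
    linarith
  have hgam0 : ∀ n, 0 < gam n := fun n => hε0.trans_le (hgam n).1
  have hgamμ : ∀ n, gam n * μ ≤ 2 * β := fun n => by
    have := (le_div_iff₀ hμ0).1 (hgam n).2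
    linarith
  have hUsym : ∀ n (v w : H), ⟪U n v, w⟫ = ⟪v, U n w⟫ := fun n =>
    (hUsa n).isSymmetric
  have hUpos : ∀ n (v : H), 0 ≤ ⟪U n v, v⟫ := fun n v =>
    (by positivity : 0 ≤ α * ‖v‖ ^ 2).trans (hUα n v)
  choose W hW using fun n => exists_right_inverse_of_coercive (U n) hα (hUα n)
  have hWsym : ∀ n (v w : H), ⟪W n v, w⟫ = ⟪v, W n w⟫ := fun n =>
    inner_right_inverse_comm (hUsym n) (hW n)
  have hWpos : ∀ n (v : H), 0 ≤ ⟪W n v, v⟫ := fun n =>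
    inner_right_inverse_nonneg (hUpos n) (hW n)
  have hWμ : ∀ n (v : H), ‖v‖ ^ 2 ≤ μ * ⟪W n v, v⟫ := fun n =>
    norm_sq_le_mul_inner_right_inverse (hUsym n) (hUpos n) (hW n) hμ0 (hUμ n)
  have hnorm : ∀ n (v : H), ‖v‖ ≤ √μ * operatorNorm (W n) v := fun n v => by
    rw [operatorNorm, ← Real.sqrt_mul hμ0.le]
    exact Real.le_sqrt_of_sq_le (hWμ n v)
  have hnorm' : ∀ n (v : H), operatorNorm (W n) v ≤ √α⁻¹ * ‖v‖ := fun n v => by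
    refine Real.sqrt_le_iff.2 ⟨by positivity, ?_⟩
    rw [mul_pow, Real.sq_sqrt (by positivity)]
    exact inner_right_inverse_le hα (hUα n) (hW n) v
  have hWstep : ∀ n (v : H), operatorNorm (W (n + 1)) v ≤ (1 + η n) * operatorNorm (W n) v := by
    intro n v
    have h1 : 1 ≤ 1 + η n := by linarith [hη0 n]
    have h2 : √(1 + η n) ≤ 1 + η n := Real.sqrt_le_iff.2 ⟨by linarith, by nlinarith⟩
    refine (operatorNorm_le_mul (by linarith) (inner_right_inverse_le_mul (hUsym n) (hUpos n)
      (hW n) (hW (n + 1)) (by linarith) (hUmono n))).trans ?_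
    exact mul_le_mul_of_nonneg_right h2 (operatorNorm_nonneg v)
  set c := 2 * ((2 * β / μ) * √μ) with hc
  set e : ℕ → ℝ := fun n => c * ‖b n‖ + √α⁻¹ * ‖a n‖ with he
  have he0 : ∀ n, 0 ≤ e n := fun n => by positivity
  have hes : Summable e := (hb.mul_left c).add (ha.mul_left _)
  have hstep : ∀ z ∈ Z, ∀ n, operatorNorm (W (n + 1)) (x (n + 1) - z)
      ≤ (1 + η n) * (operatorNorm (W n) (x n - z) + e n) := by
    intro z hz n
    rw [hZdef] at hz
    obtain ⟨u, hu, hup⟩ := hp n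
    have hinj : ∀ v : H, W n (U n v) = v := fun v => by
      refine ext_inner_right ℝ fun w => ?_
      rw [hWsym, hUsym, hW]
    have hu' : gam n • u = W n (x n - p n) - gam n • (B (x n) + b n) := by
      have h1 := congrArg (W n) hup
      simp only [map_smul, hinj] at h1
      rw [h1, hy n]
      simp only [map_sub, map_smul, hinj]
      abel
    have hmono : 0 ≤ ⟪p n - z, u + B z⟫ := by
      simpa using hAmono (p n) z u (-B z) hu hz
    have hpz := operatorNorm_forward_backward_le (hWsym n) (hWpos n) hβ hμ0.le (hgam0 n).le
      (hgamμ n) (hWμ n) (hB (x n) z) hu' hmono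
    have hpz' : operatorNorm (W n) (p n - z) ≤ operatorNorm (W n) (x n - z) + c * ‖b n‖ := by
      refine hpz.trans ?_
      have := (le_div_iff₀ hμ0).2 (hgamμ n)
      rw [hc]
      gcongr
    obtain ⟨hl, hl1⟩ := hlam n
    have hl0 : 0 ≤ lam n := hε0.le.trans hl
    have hsplit : x (n + 1) - z
        = (1 - lam n) • (x n - z) + lam n • (p n - z) + lam n • a n := by
      rw [hx n]; module
    have hadd := operatorNorm_add_le (hWsym n) (hWpos n)
    have hmain : operatorNorm (W n) (x (n + 1) - z) ≤ operatorNorm (W n) (x n - z) + e n := by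
      have h1 := hadd ((1 - lam n) • (x n - z) + lam n • (p n - z)) (lam n • a n)
      have h2 := hadd ((1 - lam n) • (x n - z)) (lam n • (p n - z))
      rw [← hsplit] at h1
      rw [operatorNorm_smul hl0] at h1
      rw [operatorNorm_smul hl0, operatorNorm_smul (by linarith)] at h2
      have h3 := mul_le_mul_of_nonneg_left hpz' hl0
      have h4 := mul_le_mul_of_nonneg_left (hnorm' n (a n)) hl0
      have h5 := mul_le_mul_of_nonneg_right hl1 (he0 n)
      simp only [he] at h5 ⊢
      linarith
    exact (hWstep n _).trans (mul_le_mul_of_nonneg_left hmain (by linarith [hη0 n]))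
  set K := Real.exp (∑' k, η k)
  have hclosed : IsClosed Z :=
    hZdef ▸ isClosed_setOf_neg_mem hAmono hAmax (continuous_of_cocoercive hβ hB)
  have hr : Tendsto (fun n => √α * ∑' k, e (k + n)) atTop (𝓝 0) := by
    simpa using (tendsto_sum_nat_add e).const_mul (√α)
  refine exists_tendsto_of_dist_le_of_liminf_infDist hZ hclosed (C := √μ * K * √α⁻¹)
    (by positivity) hr (fun z hz n m hnm => ?_) hliminf
  obtain ⟨k, rfl⟩ := Nat.exists_eq_add_of_le' hnm
  have hG := le_exp_tsum_mul_of_succ_le hη0 hηsum he0 hes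
    (fun n => operatorNorm_nonneg (W := W n) (x n - z)) (hstep z hz) n k
  have hα1 : √α⁻¹ * √α = 1 := by
    rw [← Real.sqrt_mul (by positivity), inv_mul_cancel₀ hα.ne', Real.sqrt_one]
  rw [dist_eq_norm, dist_eq_norm]
  calc ‖x (k + n) - z‖ ≤ √μ * operatorNorm (W (k + n)) (x (k + n) - z) := hnorm _ _
    _ ≤ √μ * (K * (√α⁻¹ * ‖x n - z‖ + ∑' j, e (j + n))) := by
      gcongr
      exact hG.trans (by gcongr; exact hnorm' _ _)
    _ = √μ * K * √α⁻¹ * (‖x n - z‖ + √α * ∑' j, e (j + n)) := by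
      linear_combination (-√μ * K * ∑' j, e (j + n)) * hα1
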